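/- Pointwise weighted bound for u^r = ∂_z φ: for every λ ∈ [0,1) there exists a constant C > 0, depending only on λ, such that for every t ≥ 0, every admissible g, every n ∈ ℕ, every multi-index α with |α| = n, and every (x,y,z) ∈ ℝ² × [0,∞): θ_λ(z) ⟨r⟩ⁿ |∂^α_h u^r(x,y,z)| ≤ C ( θ_λ(z) ⟨r⟩ⁿ |∂^α_h g(x,y,z)| + (z/⟨t⟩^{3/4}) θ_{λ−1}(z) ‖θ ⟨r⟩ⁿ ∂^α_h g(x,y,·)‖_{L²_z} ). -/

import Mathlib

open MeasureTheory Filter Set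

noncomputable section

/-- `⟨t⟩ = 1 + t` -/
def angT (t : ℝ) : ℝ := 1 + t

/-- `θ_λ(z) = exp (λ z² / (8⟨t⟩))`; `θ = θ₁`. -/
def thw (t lam z : ℝ) : ℝ := Real.exp (lam * z ^ 2 / (8 * angT t))

/-- `⟨r⟩ = √(x² + y² + 1)` -/
def angR (x y : ℝ) : ℝ := Real.sqrt (x ^ 2 + y ^ 2 + 1)

/-- `Mₙ = (n+1)⁴ / n!` -/
def Mfac (n : ℕ) : ℝ := ((n : ℝ) + 1) ^ 4 / (n.factorial : ℝ)

/-- `∂_x` -/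
def pdx (f : ℝ → ℝ → ℝ → ℝ) : ℝ → ℝ → ℝ → ℝ := fun x y z => deriv (fun x' => f x' y z) x
/-- `∂_y` -/
def pdy (f : ℝ → ℝ → ℝ → ℝ) : ℝ → ℝ → ℝ → ℝ := fun x y z => deriv (fun y' => f x y' z) y
/-- `∂_z` -/
def pdz (f : ℝ → ℝ → ℝ → ℝ) : ℝ → ℝ → ℝ → ℝ := fun x y z => deriv (fun z' => f x y z') z

/-- `∂^α_h = ∂_x^{α₁} ∂_y^{α₂}` for the multi-index `α = (a, b)` -/
def pdh (a b : ℕ) (f : ℝ → ℝ → ℝ → ℝ) : ℝ → ℝ → ℝ → ℝ := pdx^[a] (pdy^[b] f)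

/-- `r ∂_r = x ∂_x + y ∂_y` -/
def rdr (f : ℝ → ℝ → ℝ → ℝ) : ℝ → ℝ → ℝ → ℝ := fun x y z => x * pdx f x y z + y * pdy f x y z

/-- weighted `L²` norm over `ℝ² × (0,∞)` of `θ_λ ⟨r⟩ⁿ f` -/
def L2w (t lam : ℝ) (n : ℕ) (f : ℝ → ℝ → ℝ → ℝ) : ℝ :=
  Real.sqrt (∫ x : ℝ, ∫ y : ℝ, ∫ z in Ioi (0 : ℝ), (thw t lam z * angR x y ^ n * f x y z) ^ 2)

/-- weighted `L²_z` norm at fixed `(x, y)` of `θ_λ ⟨r⟩ⁿ f (x, y, ·)` -/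
def L2z (t lam : ℝ) (n : ℕ) (f : ℝ → ℝ → ℝ → ℝ) (x y : ℝ) : ℝ :=
  Real.sqrt (∫ z in Ioi (0 : ℝ), (thw t lam z * angR x y ^ n * f x y z) ^ 2)

/-- mixed `L^∞_h L²_z` norm of `θ_λ ⟨r⟩ⁿ f` -/
def LIh2z (t lam : ℝ) (n : ℕ) (f : ℝ → ℝ → ℝ → ℝ) : ℝ :=
  Real.sqrt (∫ z in Ioi (0 : ℝ), (⨆ p : ℝ × ℝ, |thw t lam z * angR p.1 p.2 ^ n * f p.1 p.2 z|) ^ 2)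

/-- mixed `L²_h L^∞_z` norm of `θ_λ ⟨r⟩ⁿ f` -/
def L2hIz (t lam : ℝ) (n : ℕ) (f : ℝ → ℝ → ℝ → ℝ) : ℝ :=
  Real.sqrt (∫ x : ℝ, ∫ y : ℝ,
    (⨆ z : Ioi (0 : ℝ), |thw t lam (z : ℝ) * angR x y ^ n * f x y (z : ℝ)|) ^ 2)

/-- the primitive `φ(x,y,z) = exp(−z²/(4⟨t⟩)) ∫₀^z g(x,y,s) exp(s²/(4⟨t⟩)) ds` -/
def phiF (t : ℝ) (g : ℝ → ℝ → ℝ → ℝ) : ℝ → ℝ → ℝ → ℝ := fun x y z =>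
  Real.exp (-(z ^ 2) / (4 * angT t)) * ∫ s in (0 : ℝ)..z, g x y s * Real.exp (s ^ 2 / (4 * angT t))

/-- `u^r = ∂_z φ` -/
def ur (t : ℝ) (g : ℝ → ℝ → ℝ → ℝ) : ℝ → ℝ → ℝ → ℝ := pdz (phiF t g)

/-- `u^z = −(x∂_x + y∂_y)φ − 2φ` -/
def uzv (t : ℝ) (g : ℝ → ℝ → ℝ → ℝ) : ℝ → ℝ → ℝ → ℝ := fun x y z =>
  -(rdr (phiF t g) x y z) - 2 * phiF t g x y z

/-- smoothness together with rapid decay in `z` of all derivatives -/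
def DecaySmooth (g : ℝ → ℝ → ℝ → ℝ) : Prop :=
  ContDiff ℝ (⊤ : ℕ∞) (fun p : ℝ × ℝ × ℝ => g p.1 p.2.1 p.2.2) ∧
  ∀ a b k m : ℕ, ∀ x y : ℝ,
    Tendsto (fun z : ℝ => z ^ m * pdz^[k] (pdh a b g) x y z) atTop (nhds 0)

/-- `θ ⟨r⟩^{|α|} ∂^α_h g ∈ L²(ℝ² × (0,∞))` for every `α` -/
def L2cond (t : ℝ) (g : ℝ → ℝ → ℝ → ℝ) : Prop :=
  ∀ a b : ℕ,
    Integrable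
      (fun p : ℝ × ℝ × ℝ =>
        (thw t 1 p.2.2 * angR p.1 p.2.1 ^ (a + b) * pdh a b g p.1 p.2.1 p.2.2) ^ 2)
      (volume.restrict {p : ℝ × ℝ × ℝ | 0 < p.2.2})

/-- `θ ⟨r⟩^{|α|} ∂^α_h ∂_z g ∈ L²(ℝ² × (0,∞))` for every `α` -/
def L2condZ (t : ℝ) (g : ℝ → ℝ → ℝ → ℝ) : Prop :=
  ∀ a b : ℕ,
    Integrable
      (fun p : ℝ × ℝ × ℝ =>
        (thw t 1 p.2.2 * angR p.1 p.2.1 ^ (a + b) * pdh a b (pdz g) p.1 p.2.1 p.2.2) ^ 2)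
      (volume.restrict {p : ℝ × ℝ × ℝ | 0 < p.2.2})

/-- `X_n(g, τ)` -/
def Xel (t τ : ℝ) (g : ℝ → ℝ → ℝ → ℝ) (n : ℕ) : ℝ :=
  (∑ a ∈ Finset.range (n + 1), L2w t 1 n (pdh a (n - a) g)) * τ ^ n * Mfac n

/-- `D_n(g, τ) = X_n(∂_z g, τ)` -/
def Del (t τ : ℝ) (g : ℝ → ℝ → ℝ → ℝ) (n : ℕ) : ℝ :=
  (∑ a ∈ Finset.range (n + 1), L2w t 1 n (pdh a (n - a) (pdz g))) * τ ^ n * Mfac n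

/-- `Y_n(g, τ)` (with `Y₀ = 0`) -/
def Yel (t τ : ℝ) (g : ℝ → ℝ → ℝ → ℝ) (n : ℕ) : ℝ :=
  (∑ a ∈ Finset.range (n + 1), L2w t 1 n (pdh a (n - a) g)) * τ ^ (n - 1) * (n : ℝ) * Mfac n

/-- `‖g‖_{X_τ}` -/
def Xnrm (t τ : ℝ) (g : ℝ → ℝ → ℝ → ℝ) : ℝ := ∑' n : ℕ, Xel t τ g n
/-- `‖g‖_{D_τ}` -/
def Dnrm (t τ : ℝ) (g : ℝ → ℝ → ℝ → ℝ) : ℝ := ∑' n : ℕ, Del t τ g n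
/-- `‖g‖_{Y_τ}` -/
def Ynrm (t τ : ℝ) (g : ℝ → ℝ → ℝ → ℝ) : ℝ := ∑' n : ℕ, Yel t τ g n

/-- triple integral over `ℝ² × (0,∞)` -/
def trip (F : ℝ → ℝ → ℝ → ℝ) : ℝ := ∫ x : ℝ, ∫ y : ℝ, ∫ z in Ioi (0 : ℝ), F x y z

/-- `I^α_1` -/
def I1 (t : ℝ) (g : ℝ → ℝ → ℝ → ℝ) (a b : ℕ) : ℝ :=
  -trip fun x y z =>
    thw t 2 z * angR x y ^ (2 * (a + b)) *
      pdh a b (fun x' y' z' => ur t g x' y' z' * rdr g x' y' z') x y z * pdh a b g x y z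

/-- `I^α_2` -/
def I2 (t : ℝ) (g : ℝ → ℝ → ℝ → ℝ) (a b : ℕ) : ℝ :=
  -trip fun x y z =>
    thw t 2 z * angR x y ^ (2 * (a + b)) *
      pdh a b (fun x' y' z' => uzv t g x' y' z' * pdz g x' y' z') x y z * pdh a b g x y z

/-- `I^α_3` -/
def I3 (t : ℝ) (g : ℝ → ℝ → ℝ → ℝ) (a b : ℕ) : ℝ :=
  -trip fun x y z =>
    thw t 2 z * angR x y ^ (2 * (a + b)) *
      pdh a b (fun x' y' z' => ur t g x' y' z' ^ 2) x y z * pdh a b g x y z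

/-- `I^α_4` -/
def I4 (t : ℝ) (g : ℝ → ℝ → ℝ → ℝ) (a b : ℕ) : ℝ :=
  (1 / (2 * angT t)) * trip fun x y z =>
    thw t 2 z * angR x y ^ (2 * (a + b)) *
      pdh a b
        (fun x' y' z' =>
          uzv t g x' y' z' * pdz (fun x'' y'' w => w * phiF t g x'' y'' w) x' y' z') x y z *
      pdh a b g x y z

/-- `I^α_5` -/
def I5 (t : ℝ) (g : ℝ → ℝ → ℝ → ℝ) (a b : ℕ) : ℝ :=
  -(1 / angT t) * trip fun x y z =>
    z * thw t 2 z * angR x y ^ (2 * (a + b)) *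
      pdh a b (fun x' y' z' => ur t g x' y' z' * phiF t g x' y' z') x y z * pdh a b g x y z

/-- `I^α_6` -/
def I6 (t : ℝ) (g : ℝ → ℝ → ℝ → ℝ) (a b : ℕ) : ℝ :=
  -(1 / (2 * angT t)) * trip fun x y z =>
    z * thw t 2 z * angR x y ^ (2 * (a + b)) *
      (∫ s in Ioi z, pdh a b (fun x' y' z' => ur t g x' y' z' ^ 2) x y s) * pdh a b g x y z

/-- `I^α_7` -/
def I7 (t : ℝ) (g : ℝ → ℝ → ℝ → ℝ) (a b : ℕ) : ℝ :=
  (1 / angT t) * trip fun x y z =>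
    z * thw t 2 z * angR x y ^ (2 * (a + b)) *
      (∫ s in Ioi z, pdh a b (fun x' y' z' => pdz (ur t g) x' y' z' * uzv t g x' y' z') x y s) *
      pdh a b g x y z

/-- `∑_{|α| = n} |I^α| τⁿ Mₙ / ‖θ ⟨r⟩ⁿ ∂^α_h g‖_{L²}` (with the convention `x / 0 = 0`) -/
def Qterm (t τ : ℝ) (g : ℝ → ℝ → ℝ → ℝ) (I : ℕ → ℕ → ℝ) (n : ℕ) : ℝ :=
  ∑ a ∈ Finset.range (n + 1), |I a (n - a)| * τ ^ n * Mfac n / L2w t 1 n (pdh a (n - a) g)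

/-- `∂_t` -/
def pdt (G : ℝ → ℝ → ℝ → ℝ → ℝ) (t x y z : ℝ) : ℝ := deriv (fun t' => G t' x y z) t

/-- the good-unknown axially symmetric Prandtl equation at the point `(t, x, y, z)` -/
def GoodEq (G : ℝ → ℝ → ℝ → ℝ → ℝ) (t x y z : ℝ) : Prop :=
  pdt G t x y z
      + ur t (G t) x y z * rdr (G t) x y z
      + uzv t (G t) x y z * pdz (G t) x y z
      - pdz (pdz (G t)) x y z
      + G t x y z / angT t
      + ur t (G t) x y z ^ 2
      - 1 / (2 * angT t) * (uzv t (G t) x y z * pdz (fun x' y' w => w * phiF t (G t) x' y' w) x y z)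
      + z / angT t * (ur t (G t) x y z * phiF t (G t) x y z)
      + z / (2 * angT t) * (∫ s in Ioi z, ur t (G t) x y s ^ 2)
      - z / angT t * (∫ s in Ioi z, pdz (ur t (G t)) x y s * uzv t (G t) x y s) = 0

/-- Joint smoothness of a function of three real variables. -/
def Smooth3 (f : ℝ → ℝ → ℝ → ℝ) : Prop :=
  ContDiff ℝ (⊤ : ℕ∞) (fun p : ℝ × ℝ × ℝ => f p.1 p.2.1 p.2.2)

lemma Smooth3.pdx_eq {f : ℝ → ℝ → ℝ → ℝ} (hf : Smooth3 f) (x y z : ℝ) :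
    pdx f x y z = fderiv ℝ (fun p : ℝ × ℝ × ℝ => f p.1 p.2.1 p.2.2) (x, y, z) (1, 0, 0) := by
  have hF : HasFDerivAt (fun p : ℝ × ℝ × ℝ => f p.1 p.2.1 p.2.2) _ (x, y, z) :=
    (hf.differentiable (by simp) (x, y, z)).hasFDerivAt
  have hc : HasDerivAt (fun x' : ℝ => ((x', y, z) : ℝ × ℝ × ℝ)) (1, 0, 0) x :=
    (hasDerivAt_id x).prodMk ((hasDerivAt_const x y).prodMk (hasDerivAt_const x z))
  exact (hF.comp_hasDerivAt x hc).deriv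

lemma Smooth3.pdy_eq {f : ℝ → ℝ → ℝ → ℝ} (hf : Smooth3 f) (x y z : ℝ) :
    pdy f x y z = fderiv ℝ (fun p : ℝ × ℝ × ℝ => f p.1 p.2.1 p.2.2) (x, y, z) (0, 1, 0) := by
  have hF : HasFDerivAt (fun p : ℝ × ℝ × ℝ => f p.1 p.2.1 p.2.2) _ (x, y, z) :=
    (hf.differentiable (by simp) (x, y, z)).hasFDerivAt
  have hc : HasDerivAt (fun y' : ℝ => ((x, y', z) : ℝ × ℝ × ℝ)) (0, 1, 0) y :=
    (hasDerivAt_const y x).prodMk ((hasDerivAt_id y).prodMk (hasDerivAt_const y z))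
  exact (hF.comp_hasDerivAt y hc).deriv

lemma Smooth3.fderiv_apply {f : ℝ → ℝ → ℝ → ℝ} (hf : Smooth3 f) (v : ℝ × ℝ × ℝ) :
    ContDiff ℝ (⊤ : ℕ∞)
      (fun p => fderiv ℝ (fun p : ℝ × ℝ × ℝ => f p.1 p.2.1 p.2.2) p v) :=
  (hf.fderiv_right (m := (⊤ : ℕ∞)) (by simp)).clm_apply contDiff_const

lemma Smooth3.pdx {f : ℝ → ℝ → ℝ → ℝ} (hf : Smooth3 f) : Smooth3 (pdx f) := by
  simpa only [Smooth3, hf.pdx_eq] using hf.fderiv_apply (1, 0, 0)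

lemma Smooth3.pdy {f : ℝ → ℝ → ℝ → ℝ} (hf : Smooth3 f) : Smooth3 (pdy f) := by
  simpa only [Smooth3, hf.pdy_eq] using hf.fderiv_apply (0, 1, 0)

lemma Smooth3.pdy_pdx {f : ℝ → ℝ → ℝ → ℝ} (hf : Smooth3 f) :
    _root_.pdy (_root_.pdx f) = _root_.pdx (_root_.pdy f) := by
  funext x y z
  rw [hf.pdx.pdy_eq, hf.pdy.pdx_eq]
  simp only [hf.pdx_eq, hf.pdy_eq]
  have hd : DifferentiableAt ℝ (fderiv ℝ (fun p : ℝ × ℝ × ℝ => f p.1 p.2.1 p.2.2)) (x, y, z) :=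
    (hf.fderiv_right (m := (⊤ : ℕ∞)) (by simp)).differentiable (by simp) _
  have key (v : ℝ × ℝ × ℝ) :
      fderiv ℝ (fun p => fderiv ℝ (fun p : ℝ × ℝ × ℝ => f p.1 p.2.1 p.2.2) p v) (x, y, z) =
        (fderiv ℝ (fderiv ℝ (fun p : ℝ × ℝ × ℝ => f p.1 p.2.1 p.2.2)) (x, y, z)).flip v :=
    (hd.hasFDerivAt.clm_apply (hasFDerivAt_const v _)).fderiv.trans (by ext <;> simp)
  have hs : IsSymmSndFDerivAt ℝ (fun p : ℝ × ℝ × ℝ => f p.1 p.2.1 p.2.2) (x, y, z) :=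
    hf.contDiffAt.isSymmSndFDerivAt
      (by simpa using WithTop.coe_le_coe.2 (le_top : (2 : ℕ∞) ≤ ⊤))
  simp only [Prod.mk.eta, key, ContinuousLinearMap.flip_apply]
  exact hs _ _

lemma Smooth3.iterate_pdx {f : ℝ → ℝ → ℝ → ℝ} (hf : Smooth3 f) (a : ℕ) :
    Smooth3 (_root_.pdx^[a] f) := by
  induction a with
  | zero => exact hf
  | succ a ih => rw [Function.iterate_succ_apply']; exact ih.pdx

lemma Smooth3.iterate_pdy {f : ℝ → ℝ → ℝ → ℝ} (hf : Smooth3 f) (b : ℕ) :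
    Smooth3 (_root_.pdy^[b] f) := by
  induction b with
  | zero => exact hf
  | succ b ih => rw [Function.iterate_succ_apply']; exact ih.pdy

lemma Smooth3.pdh {f : ℝ → ℝ → ℝ → ℝ} (hf : Smooth3 f) (a b : ℕ) : Smooth3 (pdh a b f) :=
  (hf.iterate_pdy b).iterate_pdx a

lemma pdx_pdh (f : ℝ → ℝ → ℝ → ℝ) (a b : ℕ) : pdx (pdh a b f) = pdh (a + 1) b f :=
  (Function.iterate_succ_apply' _ _ _).symm

lemma Smooth3.pdy_pdh {f : ℝ → ℝ → ℝ → ℝ} (hf : Smooth3 f) (a b : ℕ) :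
    _root_.pdy (_root_.pdh a b f) = _root_.pdh a (b + 1) f := by
  induction a with
  | zero => exact (Function.iterate_succ_apply' _root_.pdy b f).symm
  | succ a ih => rw [← pdx_pdh, (hf.pdh a b).pdy_pdx, ih, pdx_pdh]

/-- Differentiation under the integral sign on a compact interval. -/
lemma hasDerivAt_intervalIntegral_of_contDiff {G : ℝ → ℝ → ℝ}
    (hG : ContDiff ℝ 1 (fun p : ℝ × ℝ => G p.1 p.2)) (a b x : ℝ) :
    HasDerivAt (fun x' => ∫ s in a..b, G x' s) (∫ s in a..b, deriv (fun x' => G x' s) x) x := by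
  have hd (x s : ℝ) : HasDerivAt (fun x' => G x' s)
      (fderiv ℝ (fun p : ℝ × ℝ => G p.1 p.2) (x, s) (1, 0)) x := by
    have hF : HasFDerivAt (fun p : ℝ × ℝ => G p.1 p.2) _ (x, s) :=
      (hG.differentiable (by simp) (x, s)).hasFDerivAt
    have hc : HasDerivAt (fun x' : ℝ => ((x', s) : ℝ × ℝ)) (1, 0) x :=
      (hasDerivAt_id x).prodMk (hasDerivAt_const x s)
    exact hF.comp_hasDerivAt x hc
  have hc : Continuous (fun p : ℝ × ℝ => fderiv ℝ (fun p : ℝ × ℝ => G p.1 p.2) p (1, 0)) :=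
    (hG.continuous_fderiv (by simp)).clm_apply continuous_const
  obtain ⟨M, hM⟩ := ((isCompact_closedBall x 1).prod (isCompact_uIcc (a := a) (b := b))).bddAbove_image
    hc.norm.continuousOn
  have hG0 (x : ℝ) : Continuous (G x) := hG.continuous.comp (Continuous.prodMk_right x)
  simp only [(hd _ _).deriv]
  refine (intervalIntegral.hasDerivAt_integral_of_dominated_loc_of_deriv_le
    (F' := fun x s => fderiv ℝ (fun p : ℝ × ℝ => G p.1 p.2) (x, s) (1, 0)) (bound := fun _ => M)
    (Metric.closedBall_mem_nhds x one_pos)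
    (.of_forall fun x => (hG0 x).aestronglyMeasurable) ((hG0 x).intervalIntegrable _ _)
    (hc.comp (Continuous.prodMk_right x)).aestronglyMeasurable
    (.of_forall fun s hs x' hx' => hM (mem_image_of_mem _ ⟨hx', uIoc_subset_uIcc hs⟩))
    intervalIntegrable_const (.of_forall fun s _ x' _ => hd x' s)).2

lemma Smooth3.continuous_z {f : ℝ → ℝ → ℝ → ℝ} (hf : Smooth3 f) (x y : ℝ) :
    Continuous (f x y) :=
  hf.continuous.comp (f := fun z : ℝ => ((x, y, z) : ℝ × ℝ × ℝ)) (by fun_prop)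

lemma Smooth3.ur_eq {f : ℝ → ℝ → ℝ → ℝ} (hf : Smooth3 f) (t x y z : ℝ) :
    ur t f x y z = f x y z - z / (2 * angT t) * phiF t f x y z := by
  have hc : Continuous (fun s => f x y s * Real.exp (s ^ 2 / (4 * angT t))) :=
    (hf.continuous_z x y).mul (by fun_prop)
  have h1 : HasDerivAt (fun z => ∫ s in (0 : ℝ)..z, f x y s * Real.exp (s ^ 2 / (4 * angT t)))
      (f x y z * Real.exp (z ^ 2 / (4 * angT t))) z :=
    intervalIntegral.integral_hasDerivAt_right (hc.intervalIntegrable _ _)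
      (hc.stronglyMeasurableAtFilter _ _) hc.continuousAt
  have h2 : HasDerivAt (fun z : ℝ => Real.exp (-(z ^ 2) / (4 * angT t)))
      (Real.exp (-(z ^ 2) / (4 * angT t)) * (-(2 * z) / (4 * angT t))) z := by
    simpa using (((hasDerivAt_pow 2 z).neg).div_const (4 * angT t)).exp
  have he : Real.exp (-(z ^ 2) / (4 * angT t)) * Real.exp (z ^ 2 / (4 * angT t)) = 1 := by
    rw [← Real.exp_add, neg_div, neg_add_cancel, Real.exp_zero]
  refine (h2.mul h1).deriv.trans ?_
  simp only [phiF]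
  rw [show 4 * angT t = 2 * (2 * angT t) by ring, mul_left_comm _ (f x y z),
    show 2 * (2 * angT t) = 4 * angT t by ring, he,
    show -(2 * z) / (4 * angT t) = -(z / (2 * angT t)) by
      rw [show 4 * angT t = 2 * (2 * angT t) by ring, neg_div, mul_div_mul_left _ _ two_ne_zero]]
  ring

lemma Smooth3.pdx_ur {f : ℝ → ℝ → ℝ → ℝ} (hf : Smooth3 f) (t : ℝ) :
    _root_.pdx (ur t f) = ur t (_root_.pdx f) := by
  funext x y z
  rw [hf.pdx.ur_eq, _root_.pdx]
  simp only [hf.ur_eq, phiF]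
  have hfx (s : ℝ) : DifferentiableAt ℝ (fun x' => f x' y s) x :=
    (hf.comp (f := fun x' : ℝ => ((x', y, s) : ℝ × ℝ × ℝ)) (by fun_prop)).differentiable
      (by simp) x
  have hG : ContDiff ℝ 1 (fun p : ℝ × ℝ => f p.1 y p.2 * Real.exp (p.2 ^ 2 / (4 * angT t))) :=
    ((hf.of_le (by simp)).comp (f := fun p : ℝ × ℝ => ((p.1, y, p.2) : ℝ × ℝ × ℝ))
      (by fun_prop)).mul (by fun_prop)
  have hI := hasDerivAt_intervalIntegral_of_contDiff
    (G := fun x' s => f x' y s * Real.exp (s ^ 2 / (4 * angT t))) hG 0 z x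
  simp only [deriv_mul_const (hfx _)] at hI
  exact ((hfx z).hasDerivAt.sub ((hI.const_mul _).const_mul _)).deriv

lemma Smooth3.pdy_ur {f : ℝ → ℝ → ℝ → ℝ} (hf : Smooth3 f) (t : ℝ) :
    _root_.pdy (ur t f) = ur t (_root_.pdy f) := by
  funext x y z
  rw [hf.pdy.ur_eq, _root_.pdy]
  simp only [hf.ur_eq, phiF]
  have hfy (s : ℝ) : DifferentiableAt ℝ (fun y' => f x y' s) y :=
    (hf.comp (f := fun y' : ℝ => ((x, y', s) : ℝ × ℝ × ℝ)) (by fun_prop)).differentiable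
      (by simp) y
  have hG : ContDiff ℝ 1 (fun p : ℝ × ℝ => f x p.1 p.2 * Real.exp (p.2 ^ 2 / (4 * angT t))) :=
    ((hf.of_le (by simp)).comp (f := fun p : ℝ × ℝ => ((x, p.1, p.2) : ℝ × ℝ × ℝ))
      (by fun_prop)).mul (by fun_prop)
  have hI := hasDerivAt_intervalIntegral_of_contDiff
    (G := fun y' s => f x y' s * Real.exp (s ^ 2 / (4 * angT t))) hG 0 z y
  simp only [deriv_mul_const (hfy _)] at hI
  exact ((hfy z).hasDerivAt.sub ((hI.const_mul _).const_mul _)).deriv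

lemma Smooth3.pdh_ur {f : ℝ → ℝ → ℝ → ℝ} (hf : Smooth3 f) (t : ℝ) (a b : ℕ) :
    _root_.pdh a b (ur t f) = ur t (_root_.pdh a b f) := by
  have hy : _root_.pdy^[b] (ur t f) = ur t (_root_.pdy^[b] f) := by
    induction b with
    | zero => rfl
    | succ b ih =>
      rw [Function.iterate_succ_apply', ih, (hf.iterate_pdy b).pdy_ur,
        Function.iterate_succ_apply']
  induction a with
  | zero => exact hy
  | succ a ih => rw [← pdx_pdh, ih, (hf.pdh a b).pdx_ur, pdx_pdh]

/-- One-dimensional Sobolev inequality at a point. -/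
lemma ofReal_sq_le_lintegral_add_deriv {h : ℝ → ℝ} (hh : ContDiff ℝ 1 h) (x : ℝ) :
    ENNReal.ofReal (h x ^ 2) ≤
      2 * ∫⁻ s, (ENNReal.ofReal (h s ^ 2) + ENNReal.ofReal (deriv h s ^ 2)) := by
  have hc : Continuous h := hh.continuous
  have hc' : Continuous (deriv h) := hh.continuous_deriv le_rfl
  have hi (u : ℝ → ℝ) (hu : Continuous u) : IntervalIntegrable u volume x (x + 1) :=
    hu.intervalIntegrable _ _
  set J : ℝ := ∫ s in x..(x + 1), deriv h s ^ 2 with hJ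
  have hle : x ≤ x + 1 := by linarith
  have pt (s : ℝ) (hs : s ∈ Icc x (x + 1)) : h x ^ 2 ≤ 2 * (h s ^ 2 + J) := by
    have h1 : ∫ r in x..s, deriv h r = h s - h x :=
      intervalIntegral.integral_deriv_eq_sub (fun r _ => hh.differentiable (by simp) r)
        (hc'.intervalIntegrable _ _)
    set d := h s - h x
    have h2 : 0 ≤ ∫ r in x..s, (deriv h r - d) ^ 2 :=
      intervalIntegral.integral_nonneg hs.1 fun r _ => sq_nonneg _
    have h3 : ∫ r in x..s, (deriv h r - d) ^ 2 =
        (∫ r in x..s, deriv h r ^ 2) - 2 * d * d + (s - x) * d ^ 2 := by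
      have : ∀ r, (deriv h r - d) ^ 2 = deriv h r ^ 2 - 2 * d * deriv h r + d ^ 2 := fun r => by ring
      simp only [this]
      rw [intervalIntegral.integral_add (Continuous.intervalIntegrable (by fun_prop) _ _)
        (Continuous.intervalIntegrable (by fun_prop) _ _),
        intervalIntegral.integral_sub (Continuous.intervalIntegrable (by fun_prop) _ _)
        (Continuous.intervalIntegrable (by fun_prop) _ _),
        intervalIntegral.integral_const_mul, h1, intervalIntegral.integral_const, smul_eq_mul]
    have h4 : ∫ r in x..s, deriv h r ^ 2 ≤ J :=
      intervalIntegral.integral_mono_interval le_rfl hs.1 hs.2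
        (.of_forall fun r => sq_nonneg _) (hi _ (by fun_prop))
    have h5 : d ^ 2 ≤ J := by nlinarith [hs.2, sq_nonneg d]
    have h6 : h x = h s - d := by simp [d]
    rw [h6]
    nlinarith [sq_nonneg (h s + d)]
  have hint : h x ^ 2 ≤ 2 * ∫ s in x..(x + 1), (h s ^ 2 + deriv h s ^ 2) := by
    have h1 := intervalIntegral.integral_mono_on hle (hi _ continuous_const)
      (hi (fun s => 2 * (h s ^ 2 + J)) (by fun_prop)) pt
    rw [intervalIntegral.integral_const, intervalIntegral.integral_const_mul,
      intervalIntegral.integral_add (hi _ (by fun_prop)) (hi _ (by fun_prop)),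
      intervalIntegral.integral_const] at h1
    rw [intervalIntegral.integral_add (hi _ (by fun_prop)) (hi _ (by fun_prop))]
    simpa using h1
  have hI : IntegrableOn (fun s => h s ^ 2 + deriv h s ^ 2) (Ioc x (x + 1)) :=
    (intervalIntegrable_iff_integrableOn_Ioc_of_le hle).1 (hi _ (by fun_prop))
  calc ENNReal.ofReal (h x ^ 2)
      ≤ ENNReal.ofReal (2 * ∫ s in Ioc x (x + 1), (h s ^ 2 + deriv h s ^ 2)) := by
        rw [← intervalIntegral.integral_of_le hle]
        exact ENNReal.ofReal_le_ofReal hint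
    _ = 2 * ∫⁻ s in Ioc x (x + 1), ENNReal.ofReal (h s ^ 2 + deriv h s ^ 2) := by
        rw [ENNReal.ofReal_mul two_pos.le, ofReal_integral_eq_lintegral_ofReal hI
          (.of_forall fun s => by positivity)]
        simp
    _ ≤ 2 * ∫⁻ s, ENNReal.ofReal (h s ^ 2 + deriv h s ^ 2) := by
        gcongr
        exact Measure.restrict_le_self
    _ = _ := by simp only [ENNReal.ofReal_add (sq_nonneg _) (sq_nonneg _)]

lemma ofReal_const_mul_sq_le_lintegral {h : ℝ → ℝ} (hh : ContDiff ℝ 1 h) (c x : ℝ) :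
    ENNReal.ofReal ((c * h x) ^ 2) ≤
      2 * ∫⁻ s, (ENNReal.ofReal ((c * h s) ^ 2) + ENNReal.ofReal ((c * deriv h s) ^ 2)) := by
  have := ofReal_sq_le_lintegral_add_deriv (h := fun s => c * h s) (contDiff_const.mul hh) x
  have hd (s : ℝ) : deriv (fun s => c * h s) s = c * deriv h s :=
    deriv_const_mul c (hh.differentiable (by simp) s)
  simpa only [hd] using this

/-- Two-dimensional Sobolev inequality at a point, in the horizontal variables. -/
lemma Smooth3.ofReal_sq_le {f : ℝ → ℝ → ℝ → ℝ} (hf : Smooth3 f) (c x y z : ℝ) :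
    ENNReal.ofReal ((c * f x y z) ^ 2) ≤ 4 * ∫⁻ s, ∫⁻ u,
      (ENNReal.ofReal ((c * f s u z) ^ 2) + ENNReal.ofReal ((c * _root_.pdy f s u z) ^ 2) +
        (ENNReal.ofReal ((c * _root_.pdx f s u z) ^ 2) +
          ENNReal.ofReal ((c * _root_.pdy (_root_.pdx f) s u z) ^ 2))) := by
  have hx {f : ℝ → ℝ → ℝ → ℝ} (hf : Smooth3 f) (y z : ℝ) : ContDiff ℝ 1 (fun x => f x y z) :=
    (hf.of_le (by simp)).comp (f := fun x : ℝ => ((x, y, z) : ℝ × ℝ × ℝ)) (by fun_prop)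
  have hy {f : ℝ → ℝ → ℝ → ℝ} (hf : Smooth3 f) (x z : ℝ) : ContDiff ℝ 1 (fun y => f x y z) :=
    (hf.of_le (by simp)).comp (f := fun y : ℝ => ((x, y, z) : ℝ × ℝ × ℝ)) (by fun_prop)
  have hm {f : ℝ → ℝ → ℝ → ℝ} (hf : Smooth3 f) (s : ℝ) :
      Measurable (fun u => ENNReal.ofReal ((c * f s u z) ^ 2)) :=
    (((hy hf s z).continuous.const_mul c).pow 2).measurable.ennreal_ofReal
  refine (ofReal_const_mul_sq_le_lintegral (hx hf y z) c x).trans ?_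
  rw [show (4 : ENNReal) = 2 * 2 by norm_num, mul_assoc]
  gcongr
  rw [← lintegral_const_mul' _ _ (by simp)]
  refine lintegral_mono fun s => ?_
  refine (add_le_add (ofReal_const_mul_sq_le_lintegral (hy hf s z) c y)
    (ofReal_const_mul_sq_le_lintegral (hy hf.pdx s z) c y)).trans ?_
  rw [← mul_add]
  exact (congrArg (2 * ·) (lintegral_add_left ((hm hf s).add (hm hf.pdy s)) _).symm).le

lemma thw_continuous (t lam : ℝ) : Continuous (thw t lam) := by
  unfold thw; fun_prop

lemma one_le_angR (x y : ℝ) : 1 ≤ angR x y := by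
  rw [angR, Real.one_le_sqrt]
  nlinarith [sq_nonneg x, sq_nonneg y]

lemma L2cond.lintegral_lt_top {t : ℝ} {g : ℝ → ℝ → ℝ → ℝ} (hg : Smooth3 g) (h : L2cond t g)
    (a b : ℕ) :
    ∫⁻ z in Ioi (0 : ℝ), ∫⁻ x, ∫⁻ y, ENNReal.ofReal ((thw t 1 z * pdh a b g x y z) ^ 2) < ⊤ := by
  have hc : Continuous (fun p : ℝ × ℝ × ℝ => (thw t 1 p.2.2 * pdh a b g p.1 p.2.1 p.2.2) ^ 2) :=
    (((thw_continuous t 1).comp (by fun_prop)).mul (hg.pdh a b).continuous).pow 2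
  have hm := hc.measurable.ennreal_ofReal
  have hset : {p : ℝ × ℝ × ℝ | 0 < p.2.2} = univ ×ˢ (univ ×ˢ Ioi (0 : ℝ)) := by ext; simp
  have hfin : ∫⁻ p : ℝ × ℝ × ℝ, ENNReal.ofReal ((thw t 1 p.2.2 * pdh a b g p.1 p.2.1 p.2.2) ^ 2)
      ∂(volume.restrict {p : ℝ × ℝ × ℝ | 0 < p.2.2}) < ⊤ := by
    have h1 := (h a b).lintegral_lt_top
    refine lt_of_le_of_lt (lintegral_mono fun p => ENNReal.ofReal_le_ofReal ?_) h1
    have : (1 : ℝ) ≤ angR p.1 p.2.1 ^ (a + b) := one_le_pow₀ (one_le_angR _ _)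
    rw [mul_right_comm, mul_pow _ (angR _ _ ^ _)]
    exact le_mul_of_one_le_right (sq_nonneg _) (one_le_pow₀ this)
  rw [hset, Measure.volume_eq_prod, ← Measure.prod_restrict, Measure.volume_eq_prod,
    ← Measure.prod_restrict, Measure.restrict_univ, lintegral_prod _ hm.aemeasurable] at hfin
  convert hfin using 1
  rw [lintegral_lintegral_swap]
  · refine lintegral_congr fun x => ?_
    refine Eq.trans ?_
      (lintegral_prod _ (hm.comp (measurable_prodMk_left (x := x))).aemeasurable).symm
    refine lintegral_lintegral_swap ?_
    exact (hm.comp (f := fun q : ℝ × ℝ => ((x, q.2, q.1) : ℝ × ℝ × ℝ))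
      (by fun_prop)).aemeasurable
  · refine (Measurable.lintegral_prod_right' (f := fun q : (ℝ × ℝ) × ℝ =>
      ENNReal.ofReal ((thw t 1 q.1.1 * pdh a b g q.1.2 q.2 q.1.1) ^ 2)) ?_).aemeasurable
    exact hm.comp (f := fun q : (ℝ × ℝ) × ℝ => ((q.1.2, q.2, q.1.1) : ℝ × ℝ × ℝ)) (by fun_prop)

lemma lintegral_Ioi_lintegral_lintegral_add {F G : ℝ × ℝ × ℝ → ENNReal} (hF : Measurable F)
    (hG : Measurable G) :
    ∫⁻ z in Ioi (0 : ℝ), ∫⁻ s, ∫⁻ u, (F (z, s, u) + G (z, s, u)) =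
      (∫⁻ z in Ioi (0 : ℝ), ∫⁻ s, ∫⁻ u, F (z, s, u)) +
        ∫⁻ z in Ioi (0 : ℝ), ∫⁻ s, ∫⁻ u, G (z, s, u) := by
  have e {H : ℝ × ℝ × ℝ → ENNReal} (hH : Measurable H) :
      ∫⁻ z in Ioi (0 : ℝ), ∫⁻ s, ∫⁻ u, H (z, s, u) =
        ∫⁻ p, H p ∂((volume.restrict (Ioi (0 : ℝ))).prod (volume.prod volume)) := by
    rw [lintegral_prod _ hH.aemeasurable]
    exact lintegral_congr fun z =>
      (lintegral_prod _ (hH.comp measurable_prodMk_left).aemeasurable).symm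
  rw [e hF, e hG, ← lintegral_add_left hF]
  exact e (hF.add hG)

lemma L2cond.integrableOn {t : ℝ} {g : ℝ → ℝ → ℝ → ℝ} (hg : Smooth3 g) (h : L2cond t g)
    (a b : ℕ) (x y : ℝ) :
    IntegrableOn (fun z => (thw t 1 z * pdh a b g x y z) ^ 2) (Ioi 0) := by
  have hc : Continuous (fun z => (thw t 1 z * pdh a b g x y z) ^ 2) :=
    ((thw_continuous t 1).mul ((hg.pdh a b).continuous_z x y)).pow 2
  refine ⟨hc.aestronglyMeasurable, ?_⟩
  rw [hasFiniteIntegral_iff_ofReal (.of_forall fun z => sq_nonneg _)]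
  refine lt_of_le_of_lt
    (lintegral_mono fun z => (hg.pdh a b).ofReal_sq_le (thw t 1 z) x y z) ?_
  rw [lintegral_const_mul' _ _ (by simp)]
  refine ENNReal.mul_lt_top (by simp) ?_
  simp only [pdx_pdh, hg.pdy_pdh]
  set Φ : ℕ → ℕ → ℝ × ℝ × ℝ → ENNReal := fun a b p =>
    ENNReal.ofReal ((thw t 1 p.1 * pdh a b g p.2.1 p.2.2 p.1) ^ 2)
  have hm (a b : ℕ) : Measurable (Φ a b) := by
    have h1 : Continuous (fun p : ℝ × ℝ × ℝ => pdh a b g p.2.1 p.2.2 p.1) :=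
      (hg.pdh a b).continuous.comp
        (f := fun p : ℝ × ℝ × ℝ => ((p.2.1, p.2.2, p.1) : ℝ × ℝ × ℝ)) (by fun_prop)
    exact ((((thw_continuous t 1).comp continuous_fst).mul h1).pow 2).measurable.ennreal_ofReal
  have hfin (a b : ℕ) : ∫⁻ z in Ioi (0 : ℝ), ∫⁻ s, ∫⁻ u, Φ a b (z, s, u) < ⊤ :=
    h.lintegral_lt_top hg a b
  have key : ∫⁻ z in Ioi (0 : ℝ), ∫⁻ s, ∫⁻ u,
      ((Φ a b + Φ a (b + 1)) (z, s, u) + (Φ (a + 1) b + Φ (a + 1) (b + 1)) (z, s, u)) < ⊤ := by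
    rw [lintegral_Ioi_lintegral_lintegral_add ((hm _ _).add (hm _ _)) ((hm _ _).add (hm _ _))]
    simp only [Pi.add_apply]
    rw [lintegral_Ioi_lintegral_lintegral_add (hm _ _) (hm _ _),
      lintegral_Ioi_lintegral_lintegral_add (hm _ _) (hm _ _)]
    simp only [ENNReal.add_lt_top]
    exact ⟨⟨hfin _ _, hfin _ _⟩, hfin _ _, hfin _ _⟩
  exact key

/-- Boundedness of a Dawson-type integral. -/
lemma integral_exp_sq_le {T z : ℝ} (hT : 0 < T) (hz : 0 ≤ z) :
    ∫ s in (0 : ℝ)..z, Real.exp (s ^ 2 / (4 * T)) ≤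
      Real.exp (z ^ 2 / (4 * T)) * (4 * Real.sqrt T) := by
  have hb : 0 < 1 / (4 * T) := by positivity
  have h1 : ∫ s in (0 : ℝ)..z, Real.exp (s ^ 2 / (4 * T)) ≤
      ∫ s in (0 : ℝ)..z, Real.exp (z ^ 2 / (4 * T)) * Real.exp (-(1 / (4 * T)) * (z - s) ^ 2) := by
    refine intervalIntegral.integral_mono_on hz (Continuous.intervalIntegrable (by fun_prop) _ _)
      (Continuous.intervalIntegrable (by fun_prop) _ _) fun s hs => ?_
    rw [← Real.exp_add]
    gcongr
    have : z ^ 2 / (4 * T) + -(1 / (4 * T)) * (z - s) ^ 2 - s ^ 2 / (4 * T) =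
        2 * s * (z - s) / (4 * T) := by ring
    have h2 : 0 ≤ 2 * s * (z - s) / (4 * T) :=
      div_nonneg (mul_nonneg (by linarith [hs.1]) (by linarith [hs.2])) (by positivity)
    linarith
  refine h1.trans ?_
  rw [intervalIntegral.integral_const_mul,
    intervalIntegral.integral_comp_sub_left (fun u => Real.exp (-(1 / (4 * T)) * u ^ 2)) z,
    sub_self, sub_zero, intervalIntegral.integral_of_le hz]
  gcongr
  calc ∫ u in Ioc 0 z, Real.exp (-(1 / (4 * T)) * u ^ 2)
      ≤ ∫ u, Real.exp (-(1 / (4 * T)) * u ^ 2) :=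
        setIntegral_le_integral (integrable_exp_neg_mul_sq hb)
          (.of_forall fun u => (Real.exp_pos _).le)
    _ = Real.sqrt (Real.pi / (1 / (4 * T))) := integral_gaussian _
    _ ≤ 4 * Real.sqrt T := by
        rw [show (4 : ℝ) * Real.sqrt T = Real.sqrt (16 * T) by
          rw [Real.sqrt_mul (by norm_num), show (16 : ℝ) = 4 ^ 2 by norm_num,
            Real.sqrt_sq (by norm_num)]]
        apply Real.sqrt_le_sqrt
        rw [div_div_eq_mul_div, div_one]
        nlinarith [Real.pi_le_four]

lemma abs_integral_mul_exp_le {T z : ℝ} (hz : 0 ≤ z) {f : ℝ → ℝ} (hf : Continuous f)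
    (hi : IntegrableOn (fun s => (Real.exp (s ^ 2 / (8 * T)) * f s) ^ 2) (Ioi 0)) :
    |∫ s in (0 : ℝ)..z, f s * Real.exp (s ^ 2 / (4 * T))| ≤
      Real.sqrt (∫ s in Ioi (0 : ℝ), (Real.exp (s ^ 2 / (8 * T)) * f s) ^ 2) *
        Real.sqrt (∫ s in (0 : ℝ)..z, Real.exp (s ^ 2 / (4 * T))) := by
  have hexp (s : ℝ) : Real.exp (s ^ 2 / (4 * T)) =
      Real.exp (s ^ 2 / (8 * T)) * Real.exp (s ^ 2 / (8 * T)) := by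
    rw [← Real.exp_add]; ring_nf
  have hmem {u : ℝ → ℝ} (hu : Continuous u) :
      MemLp u (ENNReal.ofReal 2) (volume.restrict (Ioc 0 z)) := by
    rw [ENNReal.ofReal_ofNat, memLp_two_iff_integrable_sq hu.aestronglyMeasurable]
    exact (intervalIntegrable_iff_integrableOn_Ioc_of_le hz).1
      ((hu.pow 2).intervalIntegrable _ _)
  have hCS := integral_mul_le_Lp_mul_Lq_of_nonneg (μ := volume.restrict (Ioc 0 z))
    Real.HolderConjugate.two_two (f := fun s => |Real.exp (s ^ 2 / (8 * T)) * f s|)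
    (g := fun s => Real.exp (s ^ 2 / (8 * T))) (.of_forall fun s => abs_nonneg _)
    (.of_forall fun s => (Real.exp_pos _).le) (hmem (by fun_prop)) (hmem (by fun_prop))
  simp only [Real.rpow_two, sq_abs, ← Real.sqrt_eq_rpow] at hCS
  refine (intervalIntegral.abs_integral_le_integral_abs hz).trans ?_
  rw [intervalIntegral.integral_of_le hz, intervalIntegral.integral_of_le hz]
  calc ∫ s in Ioc 0 z, |f s * Real.exp (s ^ 2 / (4 * T))|
      = ∫ s in Ioc 0 z, |Real.exp (s ^ 2 / (8 * T)) * f s| * Real.exp (s ^ 2 / (8 * T)) := by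
        refine integral_congr_ae (.of_forall fun s => ?_)
        simp only [hexp, abs_mul, Real.abs_exp]
        ring
    _ ≤ _ := hCS
    _ = Real.sqrt (∫ s in Ioc 0 z, (Real.exp (s ^ 2 / (8 * T)) * f s) ^ 2) *
          Real.sqrt (∫ s in Ioc 0 z, Real.exp (s ^ 2 / (4 * T))) := by
        simp only [hexp, sq (Real.exp _)]
    _ ≤ _ := by
        refine mul_le_mul_of_nonneg_right (Real.sqrt_le_sqrt ?_) (Real.sqrt_nonneg _)
        exact setIntegral_mono_set hi (.of_forall fun s => sq_nonneg _)
          Ioc_subset_Ioi_self.eventuallyLE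

lemma abs_phiF_le {t x y z : ℝ} (ht : 0 ≤ t) (hz : 0 ≤ z) {f : ℝ → ℝ → ℝ → ℝ}
    (hf : Continuous (f x y))
    (hi : IntegrableOn (fun s => (thw t 1 s * f x y s) ^ 2) (Ioi 0)) :
    |phiF t f x y z| ≤ 2 * angT t ^ ((1 : ℝ) / 4) * thw t (-1) z * L2z t 1 0 f x y := by
  have hT : 0 < angT t := by unfold angT; linarith
  simp only [thw, one_mul] at hi
  simp only [L2z, pow_zero, mul_one, thw, one_mul, phiF, abs_mul, Real.abs_exp]
  have h1 := abs_integral_mul_exp_le hz hf hi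
  have h2 : Real.sqrt (∫ s in (0 : ℝ)..z, Real.exp (s ^ 2 / (4 * angT t))) ≤
      Real.exp (z ^ 2 / (8 * angT t)) * (2 * angT t ^ ((1 : ℝ) / 4)) := by
    refine Real.sqrt_le_iff.2 ⟨by positivity, (integral_exp_sq_le hT hz).trans_eq ?_⟩
    have h3 : Real.sqrt (angT t) = (angT t ^ ((1 : ℝ) / 4)) ^ 2 := by
      rw [← Real.rpow_natCast, ← Real.rpow_mul hT.le, Real.sqrt_eq_rpow]
      norm_num
    have h4 : Real.exp (z ^ 2 / (4 * angT t)) = Real.exp (z ^ 2 / (8 * angT t)) ^ 2 := by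
      rw [← Real.exp_nat_mul]
      ring_nf
    rw [h3, h4]
    ring
  have h5 : Real.exp (-1 * z ^ 2 / (8 * angT t)) =
      Real.exp (-(z ^ 2) / (4 * angT t)) * Real.exp (z ^ 2 / (8 * angT t)) := by
    rw [← Real.exp_add]
    ring_nf
  set N := Real.sqrt (∫ s in Ioi (0 : ℝ), (Real.exp (s ^ 2 / (8 * angT t)) * f x y s) ^ 2)
  have hN : 0 ≤ N := Real.sqrt_nonneg _
  calc _ ≤ Real.exp (-(z ^ 2) / (4 * angT t)) *
        (N * (Real.exp (z ^ 2 / (8 * angT t)) * (2 * angT t ^ ((1 : ℝ) / 4)))) := by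
        gcongr
        exact h1.trans (by gcongr)
    _ = _ := by rw [h5]; ring

lemma L2z_eq_pow_mul (t lam : ℝ) (n : ℕ) (f : ℝ → ℝ → ℝ → ℝ) (x y : ℝ) :
    L2z t lam n f x y = angR x y ^ n * L2z t lam 0 f x y := by
  have hA : 0 ≤ angR x y ^ n := pow_nonneg (Real.sqrt_nonneg _) n
  simp only [L2z, pow_zero, mul_one, mul_right_comm _ (angR x y ^ n),
    mul_pow _ (angR x y ^ n)]
  rw [integral_mul_const, Real.sqrt_mul' _ (sq_nonneg _), Real.sqrt_sq hA, mul_comm]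

/-- pointwise weighted bound for `u^r = ∂_z φ`. -/
theorem pointwise_bound_ur :
    ∀ lam : ℝ, 0 ≤ lam → lam < 1 → ∃ C : ℝ, 0 < C ∧
      ∀ t : ℝ, 0 ≤ t → ∀ g : ℝ → ℝ → ℝ → ℝ, DecaySmooth g → L2cond t g →
        ∀ n a b : ℕ, a + b = n → ∀ x y z : ℝ, 0 ≤ z →
          thw t lam z * angR x y ^ n * |pdh a b (ur t g) x y z| ≤
            C * (thw t lam z * angR x y ^ n * |pdh a b g x y z| +
              z / angT t ^ ((3 : ℝ) / 4) * thw t (lam - 1) z * L2z t 1 n (pdh a b g) x y) := by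
  intro lam _ _
  refine ⟨1, one_pos, fun t ht g hg hL n a b _ x y z hz => ?_⟩
  have hs : Smooth3 g := hg.1
  have hT : 0 < angT t := by unfold angT; linarith
  rw [one_mul, hs.pdh_ur, (hs.pdh a b).ur_eq, L2z_eq_pow_mul]
  have hφ := abs_phiF_le ht hz ((hs.pdh a b).continuous_z x y) (hL.integrableOn hs a b x y)
  set f := pdh a b g
  set N := L2z t 1 0 f x y
  set q : ℝ := angT t ^ ((1 : ℝ) / 4) with hq
  have hq0 : 0 < q := Real.rpow_pos_of_pos hT _
  have hq4 : angT t = q ^ 4 := by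
    rw [hq, ← Real.rpow_natCast, ← Real.rpow_mul hT.le]
    norm_num
  have hq3 : angT t ^ ((3 : ℝ) / 4) = q ^ 3 := by
    rw [hq, ← Real.rpow_natCast, ← Real.rpow_mul hT.le]
    norm_num
  have hθ : thw t (lam - 1) z = thw t lam z * thw t (-1) z := by
    rw [thw, thw, thw, ← Real.exp_add]
    ring_nf
  have hA : 0 ≤ angR x y ^ n := pow_nonneg (Real.sqrt_nonneg _) n
  have hθ0 : 0 ≤ thw t lam z := (Real.exp_pos _).le
  calc thw t lam z * angR x y ^ n * |f x y z - z / (2 * angT t) * phiF t f x y z|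
      ≤ thw t lam z * angR x y ^ n *
          (|f x y z| + z / (2 * angT t) * (2 * q * thw t (-1) z * N)) := by
        gcongr
        refine (abs_sub _ _).trans ?_
        rw [abs_mul, abs_of_nonneg (show 0 ≤ z / (2 * angT t) by positivity)]
        gcongr
    _ = _ := by
        rw [hθ, hq3, hq4]
        field_simp
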